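/- Let k be a positive integer and let λ = (λ_1 ≥ ⋯ ≥ λ_k ≥ 0) and μ = (μ_1 ≥ ⋯ ≥ μ_k ≥ 0) be partitions with at most k parts. Then v(μ,k) ≼ v(λ,k) if and only if μ_i ≤ λ_i for all i; that is, λ ↦ v(λ,k) is an order embedding of Young's lattice of partitions with at most k parts into (S_∞, ≼). -/

import Mathlib

/-- `S_∞`: a permutation of the positive integers lies in `S_∞` iff it
fixes all but finitely many integers. -/
def finSupp (w : Equiv.Perm ℕ+) : Prop := {i : ℕ+ | w i ≠ i}.Finite

/-- The length `ℓ(w) = #{(i,j) : i < j and w(i) > w(j)}`. -/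
noncomputable def len (w : Equiv.Perm ℕ+) : ℕ :=
  {p : ℕ+ × ℕ+ | p.1 < p.2 ∧ w p.2 < w p.1}.ncard

/-- Cover relation of the `k`-Bruhat order: `w = u∘(a,b)` with `a ≤ k < b`
and `ℓ(w) = ℓ(u) + 1`. -/
def kBruhatCover (k : ℕ) (u w : Equiv.Perm ℕ+) : Prop :=
  ∃ a b : ℕ+, (a : ℕ) ≤ k ∧ k < (b : ℕ) ∧ w = u * Equiv.swap a b ∧ len w = len u + 1

/-- The `k`-Bruhat order `≤_k`: reflexive–transitive closure of the cover relation. -/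
def kBruhatLE (k : ℕ) : Equiv.Perm ℕ+ → Equiv.Perm ℕ+ → Prop :=
  Relation.ReflTransGen (kBruhatCover k)

/-- The relation `≼` on `S_∞`: `η ≼ ζ` iff there exist a positive integer `k`
and `u ∈ S_∞` with `u ≤_k η∘u ≤_k ζ∘u`. -/
def preceq (η ζ : Equiv.Perm ℕ+) : Prop :=
  ∃ k : ℕ, 0 < k ∧ ∃ u : Equiv.Perm ℕ+, finSupp u ∧
    kBruhatLE k u (η * u) ∧ kBruhatLE k (η * u) (ζ * u)

/-- The inversions of `w`, whose number is `len w`. -/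
def inversions (w : Equiv.Perm ℕ+) : Set (ℕ+ × ℕ+) :=
  {p | p.1 < p.2 ∧ w p.2 < w p.1}

theorem len_eq_ncard_inversions (w : Equiv.Perm ℕ+) : len w = (inversions w).ncard := rfl

theorem finSupp_one : finSupp 1 := by
  simp [finSupp]

theorem finSupp.mul_swap {u : Equiv.Perm ℕ+} (hu : finSupp u) (a b : ℕ+) :
    finSupp (u * Equiv.swap a b) := by
  refine (hu.union (Set.toFinite {a, b})).subset fun i hi => ?_
  by_contra h
  simp only [Set.mem_union, Set.mem_ofPred_eq, Set.mem_insert_iff, Set.mem_singleton_iff,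
    not_or, not_not] at h
  exact hi (by simp [Equiv.swap_apply_of_ne_of_ne h.2.1 h.2.2, h.1])

theorem finSupp.finite_inversions {u : Equiv.Perm ℕ+} (hu : finSupp u) :
    (inversions u).Finite := by
  obtain ⟨N, hN⟩ := hu.bddAbove
  have hfix : ∀ i, N < i → u i = i := fun i hi => by
    by_contra h
    exact absurd (hN h) (not_le.mpr hi)
  refine ((Set.finite_Iic N).prod (Set.finite_Iic N)).subset ?_
  rintro ⟨p, q⟩ ⟨hpq, huqp⟩
  dsimp only at hpq huqp
  have hq : q ≤ N := by
    by_contra! h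
    rw [hfix q h] at huqp
    have := u.injective (hfix (u p) (h.trans huqp))
    exact lt_asymm hpq (this ▸ huqp)
  exact ⟨hpq.le.trans hq, hq⟩

theorem len_mul_swap_le {u : Equiv.Perm ℕ+} (hu : finSupp u) {a b : ℕ+} (hab : a < b)
    (h : u b < u a) : len (u * Equiv.swap a b) ≤ len u := by
  set t := Equiv.swap a b with ht
  have htt : ∀ i, t (t i) = i := Equiv.swap_apply_self a b
  refine Set.ncard_le_ncard_of_injOn
    (fun p => if t p.1 < t p.2 then (t p.1, t p.2) else p) ?_ ?_ hu.finite_inversions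
  · rintro ⟨p, q⟩ ⟨hpq, hw⟩
    simp only [Equiv.Perm.mul_apply] at hpq hw
    dsimp only
    split_ifs with hlt
    · exact ⟨hlt, hw⟩
    · refine ⟨hpq, ?_⟩
      simp only [ht, Equiv.swap_apply_def] at hlt hw ⊢
      grind
  · rintro ⟨p, q⟩ ⟨hpq, -⟩ ⟨p', q'⟩ ⟨hpq', -⟩ heq
    dsimp only at hpq hpq' heq
    split_ifs at heq with h1 h2 h2
    · simpa using heq
    · simp only [Prod.mk.injEq] at heq
      obtain ⟨rfl, rfl⟩ := heq
      simp only [htt] at h2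
      exact absurd hpq h2
    · simp only [Prod.mk.injEq] at heq
      obtain ⟨rfl, rfl⟩ := heq
      simp only [htt] at h1
      exact absurd hpq' h1
    · exact heq

theorem kBruhatCover.finSupp {k : ℕ} {u w : Equiv.Perm ℕ+} (h : kBruhatCover k u w)
    (hu : finSupp u) : finSupp w := by
  obtain ⟨a, b, -, -, rfl, -⟩ := h
  exact hu.mul_swap a b

theorem kBruhatCover.monotone {k : ℕ} {u w : Equiv.Perm ℕ+} (h : kBruhatCover k u w)
    (hu : _root_.finSupp u) (i : ℕ+) :
    ((i : ℕ) ≤ k → u i ≤ w i) ∧ (k < (i : ℕ) → w i ≤ u i) := by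
  obtain ⟨a, b, ha, hb, rfl, hlen⟩ := h
  have hab : a < b := PNat.coe_lt_coe _ _ |>.mp (ha.trans_lt hb)
  have hlt : u a ≤ u b := by
    by_contra! h
    have := len_mul_swap_le hu hab h
    omega
  rw [Equiv.Perm.mul_apply]
  rcases eq_or_ne i a with rfl | hia
  · rw [Equiv.swap_apply_left]
    exact ⟨fun _ => hlt, fun h => absurd h (by omega)⟩
  rcases eq_or_ne i b with rfl | hib
  · rw [Equiv.swap_apply_right]
    exact ⟨fun h => absurd h (by omega), fun _ => hlt⟩
  rw [Equiv.swap_apply_of_ne_of_ne hia hib]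
  exact ⟨fun _ => le_rfl, fun _ => le_rfl⟩

/-- Along the `k`-Bruhat order, values at positions up to `k` weakly increase and values at
later positions weakly decrease. -/
theorem kBruhatLE.monotone {k : ℕ} {u w : Equiv.Perm ℕ+} (h : kBruhatLE k u w)
    (hu : finSupp u) :
    finSupp w ∧ ∀ i : ℕ+, ((i : ℕ) ≤ k → u i ≤ w i) ∧ (k < (i : ℕ) → w i ≤ u i) := by
  induction h with
  | refl => exact ⟨hu, fun i => ⟨fun _ => le_rfl, fun _ => le_rfl⟩⟩
  | tail _ hc ih =>
    obtain ⟨hfin, hmono⟩ := ih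
    refine ⟨hc.finSupp hfin, fun i => ?_⟩
    exact ⟨fun hi => ((hmono i).1 hi).trans ((hc.monotone hfin i).1 hi),
      fun hi => ((hc.monotone hfin i).2 hi).trans ((hmono i).2 hi)⟩

theorem preceq.le_of_lt {η ζ : Equiv.Perm ℕ+} (h : preceq η ζ) {α : ℕ+} (hα : α < η α) :
    η α ≤ ζ α := by
  obtain ⟨k, -, u, hu, h1, h2⟩ := h
  obtain ⟨hfin, hmono⟩ := h1.monotone hu
  have hη := hmono (u.symm α)
  have hζ := (h2.monotone hfin).2 (u.symm α)
  simp only [Equiv.Perm.mul_apply, Equiv.apply_symm_apply] at hη hζ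
  refine hζ.1 (not_lt.mp fun hk => ?_)
  exact absurd (hη.2 hk) (not_le.mpr hα)

/-- Exchanging adjacent values that stand in increasing order creates exactly one inversion. -/
theorem len_mul_swap_of_succ {w : Equiv.Perm ℕ+} (hw : finSupp w) {a b : ℕ+} (hab : a < b)
    (h : w b = w a + 1) : len (w * Equiv.swap a b) = len w + 1 := by
  have key : inversions (w * Equiv.swap a b) = insert (a, b) (inversions w) := by
    ext ⟨p, q⟩
    simp only [inversions, Set.mem_ofPred_eq, Set.mem_insert_iff, Prod.mk.injEq,
      Equiv.Perm.mul_apply, Equiv.swap_apply_def]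
    have hiff : ∀ x y, (w x : ℕ) = w y ↔ (x : ℕ) = y := fun x y => by simp
    have h' : (w b : ℕ) = w a + 1 := by rw [h]; rfl
    have h1 := hiff p a
    have h2 := hiff p b
    have h3 := hiff q a
    have h4 := hiff q b
    simp only [← PNat.coe_lt_coe, ← PNat.coe_inj] at *
    split_ifs <;> omega
  rw [len_eq_ncard_inversions, key, Set.ncard_insert_of_notMem _ hw.finite_inversions,
    len_eq_ncard_inversions]
  rintro ⟨-, hlt⟩
  simp only [h] at hlt
  exact lt_asymm hlt (PNat.lt_add_right _ _)

/-- The values of `w` increase on the positions up to `k` and on the positions after `k`. -/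
def IsGrassmannian (k : ℕ+) (w : Equiv.Perm ℕ+) : Prop :=
  StrictMonoOn w (Set.Iic k) ∧ StrictMonoOn w (Set.Ioi k)

theorem isGrassmannian_one (k : ℕ+) : IsGrassmannian k 1 :=
  ⟨fun _ _ _ _ h => h, fun _ _ _ _ h => h⟩

theorem strictMonoOn_mul_swap_of_succ {w : Equiv.Perm ℕ+} {s : Set ℕ+} (hs : StrictMonoOn w s)
    {a b : ℕ+} (h : w b = w a + 1) (hab : a ∉ s ∨ b ∉ s) :
    StrictMonoOn (w * Equiv.swap a b) s := by
  intro p hp q hq hpq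
  have hlt := hs hp hq hpq
  have hne : ¬(p = a ∧ q = b) := by
    rintro ⟨rfl, rfl⟩
    exact hab.elim (· hp) (· hq)
  have hiff : ∀ x y, (w x : ℕ) = w y ↔ (x : ℕ) = y := fun x y => by simp
  have h' : (w b : ℕ) = w a + 1 := by rw [h]; rfl
  have h1 := hiff p a
  have h2 := hiff p b
  have h3 := hiff q a
  have h4 := hiff q b
  simp only [Equiv.Perm.mul_apply, Equiv.swap_apply_def]
  simp only [← PNat.coe_lt_coe, ← PNat.coe_inj] at *
  split_ifs <;> omega

theorem IsGrassmannian.eq_of_eqOn {k : ℕ+} {w v : Equiv.Perm ℕ+} (hw : IsGrassmannian k w)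
    (hv : IsGrassmannian k v) (h : ∀ j ≤ k, w j = v j) : w = v := by
  set g : Equiv.Perm ℕ+ := v⁻¹ * w with hg
  have hvg : ∀ i, v (g i) = w i := fun i => by simp [hg]
  have hfix : ∀ j ≤ k, g j = j := fun j hj => v.injective ((hvg j).trans (h j hj))
  have hgt : ∀ j, k < j → k < g j := fun j hj => by
    by_contra! hle
    have := g.injective (hfix (g j) hle)
    exact absurd (this ▸ hle) (not_le.mpr hj)
  have hmono : StrictMono g := by
    intro i j hij
    rcases le_or_gt j k with hj | hj
    · rwa [hfix i (hij.le.trans hj), hfix j hj]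
    rcases le_or_gt i k with hi | hi
    · rw [hfix i hi]
      exact hi.trans_lt (hgt j hj)
    by_contra! hle
    have := hv.2.monotoneOn (hgt j hj) (hgt i hi) hle
    rw [hvg, hvg] at this
    exact absurd (hw.2 hi hj hij) (not_lt.mpr this)
  have hone : ∀ i, g i = i := fun i =>
    congrArg (fun f : ℕ+ ≃o ℕ+ => f i)
      (Subsingleton.elim (hmono.orderIsoOfSurjective g g.surjective) (OrderIso.refl ℕ+))
  ext i
  rw [← hvg, hone]

/-- Pointwise comparison on the first `k` positions of Grassmannian permutations gives comparison
in the `k`-Bruhat order. -/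
theorem IsGrassmannian.kBruhatLE {k : ℕ+} {w v : Equiv.Perm ℕ+} (hw : IsGrassmannian k w)
    (hv : IsGrassmannian k v) (hfin : finSupp w) (hle : ∀ j ≤ k, w j ≤ v j) :
    kBruhatLE k w v := by
  induction hn : ∑ j ∈ Finset.Iic k, ((v j : ℕ) - w j) using Nat.strong_induction_on
    generalizing w with
  | _ n ih =>
  by_cases heq : ∀ j ≤ k, w j = v j
  · rw [hw.eq_of_eqOn hv heq]
    exact Relation.ReflTransGen.refl
  have hne : ((Finset.Iic k).filter fun j => w j ≠ v j).Nonempty := by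
    push Not at heq
    obtain ⟨j, hj, hj'⟩ := heq
    exact ⟨j, by simp [hj, hj']⟩
  obtain ⟨a, ha, hmax⟩ := Finset.exists_max_image _ id hne
  simp only [Finset.mem_filter, Finset.mem_Iic, id] at ha hmax
  obtain ⟨hak, hav⟩ := ha
  have hlt : w a < v a := lt_of_le_of_ne (hle a hak) hav
  obtain ⟨b, hb⟩ := w.surjective (w a + 1)
  have hkb : k < b := by
    by_contra! hbk
    have hab : a < b := (hw.1.lt_iff_lt hak hbk).mp (hb ▸ PNat.lt_add_right _ _)
    have hvb := hv.1 hak hbk hab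
    have hwb : w b = v b := by
      by_contra h
      exact absurd (hmax b ⟨hbk, h⟩) (not_le.mpr hab)
    rw [← hwb, hb] at hvb
    exact absurd (PNat.lt_add_one_iff.mp hvb) (not_le.mpr hlt)
  have hab : a < b := hak.trans_lt hkb
  have hcover : kBruhatCover k w (w * Equiv.swap a b) :=
    ⟨a, b, hak, hkb, rfl, len_mul_swap_of_succ hfin hab hb⟩
  have hwa : (w * Equiv.swap a b) a = w a + 1 := by simp [hb]
  have hwj : ∀ j ≤ k, j ≠ a → (w * Equiv.swap a b) j = w j := fun j hj hja => by
    simp [Equiv.swap_apply_of_ne_of_ne hja (hj.trans_lt hkb).ne]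
  have hle' : ∀ j ≤ k, (w * Equiv.swap a b) j ≤ v j := fun j hj => by
    rcases eq_or_ne j a with rfl | hja
    · rw [hwa]
      exact PNat.add_one_le_iff.mpr hlt
    · rw [hwj j hj hja]
      exact hle j hj
  refine Relation.ReflTransGen.head hcover (ih _ ?_
    ⟨strictMonoOn_mul_swap_of_succ hw.1 hb (Or.inr (not_le.mpr hkb)),
      strictMonoOn_mul_swap_of_succ hw.2 hb (Or.inl (not_lt.mpr hak))⟩
    (hfin.mul_swap a b) hle' rfl)
  rw [← hn]
  refine Finset.sum_lt_sum (fun j hj => ?_) ⟨a, Finset.mem_Iic.mpr hak, ?_⟩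
  · rcases eq_or_ne j a with rfl | hja
    · rw [hwa, PNat.add_coe]
      omega
    · rw [hwj j (Finset.mem_Iic.mp hj) hja]
  · have : (w a : ℕ) < v a := hlt
    rw [hwa, PNat.add_coe, PNat.one_coe]
    omega

theorem PNat.coe_add_one_sub {k j : ℕ+} (hj : j ≤ k) : ((k + 1 - j : ℕ+) : ℕ) = k + 1 - j := by
  rw [PNat.sub_coe, if_pos (PNat.lt_add_one_iff.mpr hj), PNat.add_coe, PNat.one_coe]

theorem PNat.add_one_sub_le {k j : ℕ+} (hj : j ≤ k) : k + 1 - j ≤ k := by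
  rw [← PNat.coe_le_coe, PNat.coe_add_one_sub hj]
  have := j.pos
  omega

theorem isGrassmannian_of_partition {k : ℕ+} {lam : ℕ+ → ℕ} {v : Equiv.Perm ℕ+}
    (hlam : ∀ i j : ℕ+, i ≤ j → j ≤ k → lam j ≤ lam i)
    (hv : ∀ j : ℕ+, j ≤ k → (v j : ℕ) = lam (k + 1 - j) + (j : ℕ))
    (hv' : ∀ i j : ℕ+, k < i → i < j → v i < v j) : IsGrassmannian k v := by
  refine ⟨fun i hi j hj hij => ?_, fun i hi j _ hij => hv' i j hi hij⟩
  have hle : k + 1 - j ≤ k + 1 - i := by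
    rw [← PNat.coe_le_coe, PNat.coe_add_one_sub hi, PNat.coe_add_one_sub hj]
    have : (i : ℕ) < j := hij
    omega
  have := hlam _ _ hle (PNat.add_one_sub_le hi)
  rw [← PNat.coe_lt_coe, hv i hi, hv j hj]
  have : (i : ℕ) < j := hij
  omega

/-- Theorem 3.2.3(ii): `λ ↦ v(λ,k)` is an order embedding of Young's lattice of
partitions with at most `k` parts into `(S_∞, ≼)`.  Here `vlam` (resp. `vmu`) is
the Grassmannian permutation `v(λ,k)` (resp. `v(μ,k)`), characterized by
`v(λ,k)(j) = λ_{k+1−j} + j` for `j ≤ k` and strict increase beyond `k`. -/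
theorem stmt8 (k : ℕ+) (lam mu : ℕ+ → ℕ)
    (hlam : ∀ i j : ℕ+, i ≤ j → j ≤ k → lam j ≤ lam i)
    (hmu : ∀ i j : ℕ+, i ≤ j → j ≤ k → mu j ≤ mu i)
    (vlam vmu : Equiv.Perm ℕ+)
    (hvlamfin : finSupp vlam) (hvmufin : finSupp vmu)
    (hvlam : ∀ j : ℕ+, j ≤ k → (vlam j : ℕ) = lam (k + 1 - j) + (j : ℕ))
    (hvlam' : ∀ i j : ℕ+, k < i → i < j → vlam i < vlam j)
    (hvmu : ∀ j : ℕ+, j ≤ k → (vmu j : ℕ) = mu (k + 1 - j) + (j : ℕ))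
    (hvmu' : ∀ i j : ℕ+, k < i → i < j → vmu i < vmu j) :
    preceq vmu vlam ↔ ∀ i : ℕ+, i ≤ k → mu i ≤ lam i := by
  constructor
  · intro h i hi
    have hj := PNat.add_one_sub_le hi
    have hij : k + 1 - (k + 1 - i) = i := by
      rw [← PNat.coe_inj, PNat.coe_add_one_sub hj, PNat.coe_add_one_sub hi]
      have : (i : ℕ) ≤ k := hi
      omega
    have hm := hvmu _ hj
    have hl := hvlam _ hj
    rw [hij] at hm hl
    rcases Nat.eq_zero_or_pos (mu i) with h0 | hpos
    · omega
    have hlt : k + 1 - i < vmu (k + 1 - i) := by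
      rw [← PNat.coe_lt_coe]
      omega
    have := PNat.coe_le_coe _ _ |>.mpr (h.le_of_lt hlt)
    omega
  · intro h
    have hGmu := isGrassmannian_of_partition hmu hvmu hvmu'
    have hGlam := isGrassmannian_of_partition hlam hvlam hvlam'
    refine ⟨k, k.pos, 1, finSupp_one, ?_, ?_⟩
    · rw [mul_one]
      refine (isGrassmannian_one k).kBruhatLE hGmu finSupp_one fun j hj => ?_
      rw [← PNat.coe_le_coe, hvmu j hj, Equiv.Perm.one_apply]
      omega
    · rw [mul_one, mul_one]
      refine hGmu.kBruhatLE hGlam hvmufin fun j hj => ?_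
      rw [← PNat.coe_le_coe, hvmu j hj, hvlam j hj]
      have := h _ (PNat.add_one_sub_le hj)
      omega
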